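/- For a pure bipartite i.i.d. state ρ_AR^⊗n, the partially smoothed conditional min-entropy satisfies −H_min^{ε,P}(A|Ṙ)_{ρ^⊗n} = n·H(A)_ρ + √(n·V(A)_ρ)·Φ^{−1}(√(1−ε²)) + O(log n), where H(A)_ρ and V(A)_ρ are the entropy and variance of the Schmidt coefficient distribution and Φ^{−1} is the standard normal quantile function. -/

import Mathlib

open Matrix Finset MeasureTheory
open scoped ComplexOrder Kronecker

/-- Outer product `|v⟩⟨v|`. -/
noncomputable def outer {n : Type*} (v : n → ℂ) : Matrix n n ℂ :=
  Matrix.of fun i j => v i * star (v j)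

/-- Partial trace over the first (A) factor. -/
noncomputable def ptraceA {dA dR : Type*} [Fintype dA]
    (σ : Matrix (dA × dR) (dA × dR) ℂ) : Matrix dR dR ℂ :=
  Matrix.of fun r r' => ∑ a, σ (a, r) (a, r')

/-- The quantile function of the standard normal distribution,
`Φ⁻¹(x) = sup { z : (1/√(2π)) ∫_{−∞}^z e^{−t²/2} dt ≤ x }`. -/
noncomputable def PhiInv (x : ℝ) : ℝ :=
  sSup {z : ℝ | (1 / Real.sqrt (2 * Real.pi)) *
    (∫ t in Set.Iic z, Real.exp (-t ^ 2 / 2)) ≤ x}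

/-- The n-fold product distribution of `p`. -/
noncomputable def prodDist {d : ℕ} (p : Fin d → ℝ) (n : ℕ) : (Fin n → Fin d) → ℝ :=
  fun x => ∏ j, p (x j)

/-- The partially smoothed conditional min-entropy
`H_min^{ε,P}(A|Ṙ)` of the n-fold tensor power of the pure state
`|ρ⟩ = Σ_x √p_x |xx⟩`; for a pure state the purified-distance smoothing constraint
`P(ρ^{⊗n}, σ) ≤ ε` is equivalent to `Tr[ρ^{⊗n} σ] ≥ 1 − ε²`. -/
noncomputable def HminPartialPure {d : ℕ} (p : Fin d → ℝ) (ε : ℝ) (n : ℕ) : ℝ :=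
  -Real.logb 2 (sInf {l : ℝ | 0 ≤ l ∧
    ∃ σ : Matrix ((Fin n → Fin d) × (Fin n → Fin d))
            ((Fin n → Fin d) × (Fin n → Fin d)) ℂ,
      ((l : ℂ) • ((1 : Matrix (Fin n → Fin d) (Fin n → Fin d) ℂ) ⊗ₖ
          (Matrix.diagonal fun x => (prodDist p n x : ℂ))) - σ).PosSemidef ∧
      1 - ε ^ 2 ≤ (((outer fun xy : (Fin n → Fin d) × (Fin n → Fin d) =>
          if xy.1 = xy.2 then (Real.sqrt (prodDist p n xy.1) : ℂ) else 0) * σ).trace).re ∧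
      ((Matrix.diagonal fun x => (prodDist p n x : ℂ)) - ptraceA σ).PosSemidef ∧
      σ.PosSemidef})


section Quantum

variable {ι : Type*} [Fintype ι] [DecidableEq ι]

lemma gram_of_posSemidef {κ : Type*} [Finite κ] {σ : Matrix κ κ ℂ} (h : σ.PosSemidef) :
    ∃ (m : ℕ) (u : κ → EuclideanSpace ℂ (Fin m)), ∀ a b, σ a b = inner ℂ (u a) (u b) := by
  obtain ⟨m, v, rfl⟩ := Matrix.posSemidef_iff_eq_sum_vecMulVec.mp h
  refine ⟨m, fun a => WithLp.toLp 2 (fun k => star (v k a)), fun a b => ?_⟩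
  simp [PiLp.inner_apply, Matrix.sum_apply, Matrix.vecMulVec_apply, mul_comm]

lemma gram_quad {m : ℕ} (u : ι × ι → EuclideanSpace ℂ (Fin m)) (σ : Matrix (ι × ι) (ι × ι) ℂ)
    (hu : ∀ a b, σ a b = inner ℂ (u a) (u b)) (c : ι → ℝ) :
    (star (fun xy : ι × ι => if xy.1 = xy.2 then (c xy.1 : ℂ) else 0) ⬝ᵥ
      σ *ᵥ (fun xy : ι × ι => if xy.1 = xy.2 then (c xy.1 : ℂ) else 0)).re
      = ‖∑ x, (c x : ℂ) • u (x, x)‖ ^ 2 := by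
  rw [← inner_self_eq_norm_sq (𝕜 := ℂ)]
  simp only [dotProduct, Matrix.mulVec, Fintype.sum_prod_type, sum_inner, inner_sum,
    inner_smul_left, inner_smul_right, Pi.star_apply, hu]
  simp [Finset.mul_sum, apply_ite, mul_comm, mul_left_comm]
  exact Finset.sum_congr rfl fun x _ => Finset.sum_congr rfl fun y _ => by
    rw [← inner_conj_symm, Complex.conj_re]

lemma converse_bound (P : ι → ℝ) (hP : ∀ x, 0 ≤ P x) (hPs : ∑ x, P x = 1) (l e t : ℝ)
    (hl : 0 ≤ l) (ht : 0 ≤ t)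
    (σ : Matrix (ι × ι) (ι × ι) ℂ)
    (h1 : ((l : ℂ) • ((1 : Matrix ι ι ℂ) ⊗ₖ
          (Matrix.diagonal fun x => (P x : ℂ))) - σ).PosSemidef)
    (h2 : e ≤ (((outer fun xy : ι × ι =>
          if xy.1 = xy.2 then (Real.sqrt (P xy.1) : ℂ) else 0) * σ).trace).re)
    (h3 : ((Matrix.diagonal fun x => (P x : ℂ)) - ptraceA σ).PosSemidef)
    (h4 : σ.PosSemidef) :
    Real.sqrt e ≤ ∑ x ∈ Finset.univ.filter (fun x => t < P x), P x + Real.sqrt (l * t) := by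
  obtain ⟨m, u, hu⟩ := gram_of_posSemidef h4
  set S := Finset.univ.filter (fun x => t < P x) with hS
  have htr : (((outer fun xy : ι × ι =>
          if xy.1 = xy.2 then (Real.sqrt (P xy.1) : ℂ) else 0) * σ).trace).re
      = ‖∑ x, ((Real.sqrt (P x) : ℝ) : ℂ) • u (x, x)‖ ^ 2 := by
    rw [← gram_quad u σ hu (fun x => Real.sqrt (P x))]
    congr 1
    simp only [Matrix.trace, Matrix.diag, Matrix.mul_apply, outer, Matrix.of_apply,
      dotProduct, Matrix.mulVec, Finset.mul_sum, Pi.star_apply]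
    rw [Finset.sum_comm]
    refine Finset.sum_congr rfl fun a _ => Finset.sum_congr rfl fun b _ => ?_
    ring
  rw [htr] at h2
  have hdiag : ∀ x, ‖u (x, x)‖ ≤ Real.sqrt (P x) := by
    intro x
    apply Real.le_sqrt_of_sq_le
    have h := h3.diag_nonneg (i := x)
    have hre := (Complex.le_def.mp h).1
    simp only [ptraceA, Matrix.sub_apply, Matrix.diagonal_apply_eq, Matrix.of_apply,
      Complex.zero_re, Complex.sub_re, Complex.ofReal_re, Complex.re_sum, hu] at hre
    have h5 : ∀ a, (inner ℂ (u (a, x)) (u (a, x))).re = ‖u (a, x)‖ ^ 2 :=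
      fun a => inner_self_eq_norm_sq (𝕜 := ℂ) _
    simp only [h5] at hre
    have := Finset.single_le_sum (f := fun a => ‖u (a, x)‖ ^ 2)
      (fun a _ => by positivity) (Finset.mem_univ x)
    linarith
  have hbig : ‖∑ x ∈ S, ((Real.sqrt (P x) : ℝ) : ℂ) • u (x, x)‖ ≤ ∑ x ∈ S, P x := by
    refine (norm_sum_le _ _).trans (Finset.sum_le_sum fun x _ => ?_)
    rw [norm_smul, Complex.norm_real, Real.norm_eq_abs, abs_of_nonneg (Real.sqrt_nonneg _)]
    calc _ ≤ Real.sqrt (P x) * Real.sqrt (P x) :=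
          mul_le_mul_of_nonneg_left (hdiag x) (Real.sqrt_nonneg _)
      _ = P x := Real.mul_self_sqrt (hP x)
  have hsmall : ‖∑ x ∈ Sᶜ, ((Real.sqrt (P x) : ℝ) : ℂ) • u (x, x)‖ ≤ Real.sqrt (l * t) := by
    apply Real.le_sqrt_of_sq_le
    set c : ι → ℝ := fun x => if x ∈ Sᶜ then Real.sqrt (P x) else 0 with hc
    have e1 : ∑ x ∈ Sᶜ, ((Real.sqrt (P x) : ℝ) : ℂ) • u (x, x) = ∑ x, (c x : ℂ) • u (x, x) := by
      rw [← Finset.sum_subset (Finset.subset_univ Sᶜ)]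
      · refine Finset.sum_congr rfl fun x hx => ?_
        simp only [hc, if_pos hx]
      · intro x _ hx
        simp only [hc, if_neg hx]
        simp
    rw [e1, ← gram_quad u σ hu c]
    have h := h1.dotProduct_mulVec_nonneg
      (fun xy : ι × ι => if xy.1 = xy.2 then (c xy.1 : ℂ) else 0)
    have hre := (Complex.le_def.mp h).1
    rw [Matrix.sub_mulVec, dotProduct_sub, Complex.sub_re, Complex.zero_re] at hre
    refine (sub_nonneg.mp hre).trans ?_
    have e2 : (star (fun xy : ι × ι => if xy.1 = xy.2 then (c xy.1 : ℂ) else 0) ⬝ᵥ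
      ((l : ℂ) • ((1 : Matrix ι ι ℂ) ⊗ₖ (Matrix.diagonal fun x => (P x : ℂ)))) *ᵥ
        (fun xy : ι × ι => if xy.1 = xy.2 then (c xy.1 : ℂ) else 0)).re
        = l * ∑ x, c x * c x * P x := by
      simp only [dotProduct, Matrix.mulVec, Fintype.sum_prod_type, Matrix.smul_apply,
        Matrix.kroneckerMap_apply, Matrix.one_apply, Matrix.diagonal_apply, Pi.star_apply]
      simp [Finset.mul_sum, apply_ite, mul_comm, mul_left_comm, mul_assoc]
    rw [e2]
    refine mul_le_mul_of_nonneg_left ?_ hl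
    calc ∑ x, c x * c x * P x ≤ ∑ x, P x * t := by
          refine Finset.sum_le_sum fun x _ => ?_
          by_cases hx : x ∈ Sᶜ
          · simp only [hc, if_pos hx, Real.mul_self_sqrt (hP x)]
            refine mul_le_mul_of_nonneg_left ?_ (hP x)
            simpa [hS] using hx
          · simp only [hc, if_neg hx]
            have := mul_nonneg (hP x) ht
            simpa using this
      _ = t := by rw [← Finset.sum_mul, hPs, one_mul]
  calc Real.sqrt e ≤ ‖∑ x, ((Real.sqrt (P x) : ℝ) : ℂ) • u (x, x)‖ :=
        Real.sqrt_le_iff.mpr ⟨norm_nonneg _, h2⟩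
    _ = ‖∑ x ∈ S, ((Real.sqrt (P x) : ℝ) : ℂ) • u (x, x)
          + ∑ x ∈ Sᶜ, ((Real.sqrt (P x) : ℝ) : ℂ) • u (x, x)‖ := by
        rw [Finset.sum_add_sum_compl]
    _ ≤ _ := norm_add_le _ _
    _ ≤ _ := add_le_add hbig hsmall

lemma achiev (P : ι → ℝ) (hP : ∀ x, 0 ≤ P x) (e : ℝ) (S : Finset ι)
    (he : Real.sqrt e ≤ ∑ x ∈ S, P x) (he0 : 0 ≤ e) :
    ∃ σ : Matrix (ι × ι) (ι × ι) ℂ,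
    ((((S.card : ℝ)) : ℂ) • ((1 : Matrix ι ι ℂ) ⊗ₖ
          (Matrix.diagonal fun x => (P x : ℂ))) - σ).PosSemidef ∧
    e ≤ (((outer fun xy : ι × ι =>
          if xy.1 = xy.2 then (Real.sqrt (P xy.1) : ℂ) else 0) * σ).trace).re ∧
    ((Matrix.diagonal fun x => (P x : ℂ)) - ptraceA σ).PosSemidef ∧
    σ.PosSemidef := by
  set c : ι → ℝ := fun x => if x ∈ S then Real.sqrt (P x) else 0 with hc
  set g : ι × ι → ℂ := fun xy => if xy.1 = xy.2 then (c xy.1 : ℂ) else 0 with hg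
  have hpsd : (vecMulVec g (star g)).PosSemidef := Matrix.posSemidef_vecMulVec_self_star g
  have hcc : ∀ x, c x * c x = if x ∈ S then P x else 0 := by
    intro x
    by_cases hx : x ∈ S <;> simp [hc, hx, Real.mul_self_sqrt (hP x)]
  have hD : ((1 : Matrix ι ι ℂ) ⊗ₖ (Matrix.diagonal fun x => (P x : ℂ)))
      = Matrix.diagonal (fun xy : ι × ι => (P xy.2 : ℂ)) := by
    ext ⟨a, b⟩ ⟨a', b'⟩
    by_cases h : a = a' <;> by_cases h' : b = b' <;>
      simp [Matrix.kroneckerMap_apply, Matrix.one_apply, Matrix.diagonal_apply, h, h']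
  refine ⟨vecMulVec g (star g), ?_, ?_, ?_, hpsd⟩
  · rw [hD]
    refine Matrix.PosSemidef.of_dotProduct_mulVec_nonneg ?_ ?_
    · refine Matrix.IsHermitian.sub ?_ hpsd.1
      rw [← Matrix.diagonal_smul]
      refine Matrix.isHermitian_diagonal_of_self_adjoint _ ?_
      ext x
      simp
    · intro w
      have e1 : star w ⬝ᵥ (((S.card : ℝ) : ℂ) • Matrix.diagonal (fun xy : ι × ι => (P xy.2 : ℂ))
          - vecMulVec g (star g)) *ᵥ w
          = (((S.card : ℝ) * ∑ xy, P xy.2 * ‖w xy‖ ^ 2 - ‖∑ x, (c x : ℂ) * w (x, x)‖ ^ 2 : ℝ) : ℂ) := by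
        rw [Matrix.sub_mulVec, dotProduct_sub]
        push_cast
        congr 1
        · rw [← Matrix.diagonal_smul]
          simp only [dotProduct, Matrix.mulVec_diagonal, Finset.mul_sum]
          refine Finset.sum_congr rfl fun x _ => ?_
          rw [← Complex.conj_mul']
          simp
          ring
        · rw [Matrix.vecMulVec_mulVec, ← Complex.conj_mul']
          have : star g ⬝ᵥ w = ∑ x, (c x : ℂ) * w (x, x) := by
            simp [dotProduct, hg, Fintype.sum_prod_type, apply_ite]
          have h2 : star w ⬝ᵥ g = (starRingEnd ℂ) (∑ x, (c x : ℂ) * w (x, x)) := by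
            rw [← this]
            simp [dotProduct, mul_comm]
          simp [this, h2]
      rw [e1]
      rw [Complex.zero_le_real, sub_nonneg]
      have f1 : ‖∑ x, (c x : ℂ) * w (x, x)‖ ≤ ∑ x ∈ S, Real.sqrt (P x) * ‖w (x, x)‖ := by
        have : ∑ x, (c x : ℂ) * w (x, x) = ∑ x ∈ S, (c x : ℂ) * w (x, x) := by
          symm
          apply Finset.sum_subset (Finset.subset_univ S)
          intro x _ hx
          simp [hc, hx]
        rw [this]
        refine (norm_sum_le _ _).trans (Finset.sum_le_sum fun x hx => ?_)
        rw [norm_mul, Complex.norm_real, Real.norm_eq_abs]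
        simp [hc, hx, abs_of_nonneg (Real.sqrt_nonneg _)]
      calc _ ≤ (∑ x ∈ S, Real.sqrt (P x) * ‖w (x, x)‖) ^ 2 := by gcongr
        _ ≤ (S.card : ℝ) * ∑ x ∈ S, (Real.sqrt (P x) * ‖w (x, x)‖) ^ 2 := sq_sum_le_card_mul_sum_sq
        _ = (S.card : ℝ) * ∑ x ∈ S, P x * ‖w (x, x)‖ ^ 2 := by
          congr 1
          refine Finset.sum_congr rfl fun x _ => ?_
          rw [mul_pow, Real.sq_sqrt (hP x)]
        _ ≤ _ := by
          refine mul_le_mul_of_nonneg_left ?_ (Nat.cast_nonneg _)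
          rw [Fintype.sum_prod_type_right]
          calc _ ≤ ∑ x, P x * ‖w (x, x)‖ ^ 2 :=
                Finset.sum_le_sum_of_subset_of_nonneg (Finset.subset_univ S)
                  (fun x _ _ => mul_nonneg (hP x) (by positivity))
            _ ≤ _ := Finset.sum_le_sum fun x _ =>
                Finset.single_le_sum (f := fun a => P x * ‖w (a, x)‖ ^ 2)
                  (fun a _ => mul_nonneg (hP x) (by positivity)) (Finset.mem_univ x)
  · have : (((outer fun xy : ι × ι =>
          if xy.1 = xy.2 then (Real.sqrt (P xy.1) : ℂ) else 0) * vecMulVec g (star g)).trace)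
          = (((∑ x ∈ S, P x) ^ 2 : ℝ) : ℂ) := by
      have ho : (outer fun xy : ι × ι =>
          if xy.1 = xy.2 then (Real.sqrt (P xy.1) : ℂ) else 0) =
          vecMulVec (fun xy : ι × ι =>
          if xy.1 = xy.2 then (Real.sqrt (P xy.1) : ℂ) else 0) (star (fun xy : ι × ι =>
          if xy.1 = xy.2 then (Real.sqrt (P xy.1) : ℂ) else 0)) := rfl
      have hs : ∑ x, ((Real.sqrt (P x) : ℝ) : ℂ) * (c x : ℂ) = ((∑ x ∈ S, P x : ℝ) : ℂ) := by
        rw [← Finset.sum_subset (Finset.subset_univ S)]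
        · push_cast
          refine Finset.sum_congr rfl fun x hx => ?_
          simp only [hc, if_pos hx]
          rw [← Complex.ofReal_mul, Real.mul_self_sqrt (hP x)]
        · intro x _ hx
          simp [hc, hx]
      have hs1 : (star (fun xy : ι × ι =>
          if xy.1 = xy.2 then (Real.sqrt (P xy.1) : ℂ) else 0)) ⬝ᵥ g = ((∑ x ∈ S, P x : ℝ) : ℂ) := by
        rw [← hs]
        simp [dotProduct, hg, Fintype.sum_prod_type, apply_ite]
      have hs2 : (fun xy : ι × ι =>
          if xy.1 = xy.2 then (Real.sqrt (P xy.1) : ℂ) else 0) ⬝ᵥ star g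
            = ((∑ x ∈ S, P x : ℝ) : ℂ) := by
        rw [← hs]
        simp [dotProduct, hg, Fintype.sum_prod_type, apply_ite]
      rw [ho, Matrix.vecMulVec_mul_vecMulVec, Matrix.trace_vecMulVec, hs1, dotProduct_smul, hs2]
      push_cast
      rw [smul_eq_mul, sq]
    rw [this, Complex.ofReal_re]
    calc e = Real.sqrt e ^ 2 := (Real.sq_sqrt he0).symm
      _ ≤ _ := by gcongr
  · have : (Matrix.diagonal fun x => (P x : ℂ)) - ptraceA (vecMulVec g (star g))
        = Matrix.diagonal fun x => (((if x ∈ S then 0 else P x) : ℝ) : ℂ) := by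
      ext r r'
      simp only [Matrix.sub_apply, ptraceA, Matrix.of_apply, Matrix.vecMulVec_apply, hg,
        Matrix.diagonal_apply, Pi.star_apply]
      by_cases h : r = r'
      · subst h
        have := hcc r
        simp [apply_ite]
        rw [← Complex.ofReal_mul, this]
        by_cases hr : r ∈ S <;> simp [hr, hc]
      · simp [h, apply_ite]
        exact fun h' => absurd h'.symm h
    rw [this]
    refine Matrix.PosSemidef.diagonal fun x => ?_
    simp only [Pi.zero_apply, Complex.zero_le_real]
    split_ifs
    · exact le_rfl
    · exact hP x

end Quantum

section Fourier
open ProbabilityTheory Filter Topology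
open scoped NNReal

lemma gaussian_cdf_eq {v : ℝ≥0} (hv : v ≠ 0) (x : ℝ) :
    (gaussianReal 0 v).real (Set.Iic x) = ∫ y in Set.Iic x, gaussianPDFReal 0 v y := by
  rw [Measure.real, gaussianReal_apply_eq_integral 0 hv, ENNReal.toReal_ofReal]
  exact integral_nonneg fun y => gaussianPDFReal_nonneg _ _ _

lemma gaussian_cdf_sub {v : ℝ≥0} (hv : v ≠ 0) (a b w : ℝ) :
    (gaussianReal 0 v).real (Set.Iic (b - w)) - (gaussianReal 0 v).real (Set.Iic (a - w))
      = ∫ y in a..b, gaussianPDFReal 0 v (y - w) := by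
  rw [gaussian_cdf_eq hv, gaussian_cdf_eq hv, intervalIntegral.integral_Iic_sub_Iic
    (integrable_gaussianPDFReal 0 v).integrableOn (integrable_gaussianPDFReal 0 v).integrableOn,
    intervalIntegral.integral_comp_sub_right]

lemma gaussian_pdf_fourier {v : ℝ≥0} (hv : v ≠ 0) (y w : ℝ) :
    (gaussianPDFReal 0 v (y - w) : ℂ) = (1 / (2 * Real.pi) : ℝ) *
      ∫ t : ℝ, Complex.exp (t * w * Complex.I) * Complex.exp (-(t * y * Complex.I)) *
        (Real.exp (-(v / 2) * t ^ 2) : ℂ) := by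
  have hv0 : (0 : ℝ) < v := by positivity
  have hb : 0 < ((v / 2 : ℝ) : ℂ).re := by simpa using hv0
  have h := fourierIntegral_gaussian hb ((w - y : ℝ) : ℂ)
  have e1 : ∀ t : ℝ, Complex.exp (t * w * Complex.I) * Complex.exp (-(t * y * Complex.I)) *
        (Real.exp (-(v / 2) * t ^ 2) : ℂ)
      = Complex.exp (Complex.I * ((w - y : ℝ) : ℂ) * t) *
        Complex.exp (-((v / 2 : ℝ) : ℂ) * t ^ 2) := by
    intro t
    rw [← Complex.exp_add]
    push_cast
    congr 2
    ring
  simp_rw [e1]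
  rw [h, gaussianPDFReal_def]
  have e2 : ((Real.pi : ℂ) / ((v / 2 : ℝ) : ℂ)) ^ (1 / 2 : ℂ)
      = (Real.sqrt (Real.pi / (v / 2)) : ℂ) := by
    rw [Real.sqrt_eq_rpow, Complex.ofReal_cpow (by positivity)]
    push_cast
    rfl
  have e3 : Complex.exp (-((w - y : ℝ) : ℂ) ^ 2 / (4 * ((v / 2 : ℝ) : ℂ)))
      = ((Real.exp (-(y - w - 0) ^ 2 / (2 * v)) : ℝ) : ℂ) := by
    push_cast
    congr 1
    have : (v : ℂ) ≠ 0 := by exact_mod_cast hv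
    field_simp
    ring
  rw [e2, e3, ← Complex.ofReal_mul, ← Complex.ofReal_mul, ← mul_assoc]
  congr 2
  have h1 : Real.sqrt (Real.pi / (v / 2)) = Real.sqrt (2 * Real.pi * v) / v := by
    rw [show Real.pi / ((v : ℝ) / 2) = (2 * Real.pi * v) / v ^ 2 by field_simp,
      Real.sqrt_div' _ (by positivity), Real.sqrt_sq hv0.le]
  rw [h1]
  have h2 : Real.sqrt (2 * Real.pi * v) ^ 2 = 2 * Real.pi * v := Real.sq_sqrt (by positivity)
  have h3 : 0 < Real.sqrt (2 * Real.pi * v) := by positivity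
  field_simp
  rw [h2]

lemma smoothed_fourier (μ : Measure ℝ) [IsProbabilityMeasure μ] {v : ℝ≥0} (hv : v ≠ 0)
    (a b : ℝ) (hab : a ≤ b) :
    ((∫ w, ((gaussianReal 0 v).real (Set.Iic (b - w)) - (gaussianReal 0 v).real (Set.Iic (a - w)))
      ∂μ : ℝ) : ℂ) = (1 / (2 * Real.pi) : ℝ) *
      ∫ t : ℝ, charFun μ t * (∫ y in a..b, Complex.exp (-(t * y * Complex.I))) *
        (Real.exp (-(v / 2) * t ^ 2) : ℂ) := by
  have hv0 : (0 : ℝ) < v := by positivity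
  set m : Measure ℝ := volume.restrict (Set.Ioc a b) with hm
  have hbd : ∀ x, gaussianPDFReal 0 v x ≤ (√(2 * Real.pi * v))⁻¹ := by
    intro x
    rw [gaussianPDFReal_def]
    refine mul_le_of_le_one_right (by positivity) (Real.exp_le_one_iff.mpr ?_)
    exact div_nonpos_of_nonpos_of_nonneg (by nlinarith [sq_nonneg (x - 0)]) (by positivity)
  have hInteg1 : Integrable (fun z : ℝ × ℝ => gaussianPDFReal 0 v (z.2 - z.1)) (μ.prod m) := by
    refine Integrable.of_bound
      ((measurable_gaussianPDFReal 0 v).comp (measurable_snd.sub measurable_fst)).aestronglyMeasurable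
      (√(2 * Real.pi * v))⁻¹ (Eventually.of_forall fun z => ?_)
    rw [Real.norm_eq_abs, abs_of_nonneg (gaussianPDFReal_nonneg _ _ _)]
    exact hbd _
  have hInteg2 : Integrable (Function.uncurry fun (z : ℝ × ℝ) (t : ℝ) =>
      Complex.exp (t * z.1 * Complex.I) * Complex.exp (-(t * z.2 * Complex.I)) *
        (Real.exp (-(v / 2) * t ^ 2) : ℂ)) ((μ.prod m).prod volume) := by
    have h0 : Integrable (fun q : (ℝ × ℝ) × ℝ => (1 : ℝ) * Real.exp (-(v / 2) * q.2 ^ 2))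
        ((μ.prod m).prod volume) :=
      Integrable.mul_prod (f := fun _ : ℝ × ℝ => (1 : ℝ)) (integrable_const _)
        (integrable_exp_neg_mul_sq (by positivity))
    refine Integrable.mono' h0 ?_ (Eventually.of_forall ?_)
    · apply Continuous.aestronglyMeasurable
      simp only [Function.uncurry_def]
      fun_prop
    · rintro ⟨⟨w, y⟩, t⟩
      simp only [Function.uncurry_apply_pair, norm_mul, one_mul]
      rw [show (t : ℂ) * w * Complex.I = ((t * w : ℝ) : ℂ) * Complex.I by push_cast; ring,
        show -((t : ℂ) * y * Complex.I) = ((-(t * y) : ℝ) : ℂ) * Complex.I by push_cast; ring,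
        Complex.norm_exp_ofReal_mul_I, Complex.norm_exp_ofReal_mul_I, Complex.norm_real,
        Real.norm_eq_abs, abs_of_pos (Real.exp_pos _)]
      simp
  have hs1 : (∫ w, ((gaussianReal 0 v).real (Set.Iic (b - w))
      - (gaussianReal 0 v).real (Set.Iic (a - w))) ∂μ)
      = ∫ z, gaussianPDFReal 0 v (z.2 - z.1) ∂(μ.prod m) := by
    rw [integral_prod _ hInteg1]
    refine integral_congr_ae (Eventually.of_forall fun w => ?_)
    simp only
    rw [gaussian_cdf_sub hv, intervalIntegral.integral_of_le hab]
  rw [hs1, ← integral_complex_ofReal]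
  simp_rw [gaussian_pdf_fourier hv]
  rw [integral_const_mul, integral_integral_swap hInteg2]
  congr 1
  refine integral_congr_ae (Eventually.of_forall fun t => ?_)
  simp only
  rw [integral_mul_const]
  congr 1
  rw [integral_prod_mul (fun w : ℝ => Complex.exp (t * w * Complex.I))
    (fun y : ℝ => Complex.exp (-(t * y * Complex.I))), charFun_apply_real,
    intervalIntegral.integral_of_le hab]

lemma norm_osc_le (a b t : ℝ) (ht : t ≠ 0) :
    ‖∫ y in a..b, Complex.exp (-(t * y * Complex.I))‖ ≤ 2 / |t| := by
  have hc : (-(t * Complex.I) : ℂ) ≠ 0 := by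
    simp [ht]
  have h := integral_exp_mul_complex (a := a) (b := b) hc
  have e : ∀ y : ℝ, Complex.exp (-(t * y * Complex.I)) = Complex.exp (-(t * Complex.I) * y) := by
    intro y
    congr 1
    ring
  simp_rw [e]
  rw [h, norm_div]
  have e2 : ‖(-(t * Complex.I) : ℂ)‖ = |t| := by simp
  rw [e2]
  gcongr
  refine (norm_sub_le _ _).trans ?_
  rw [show (-(t * Complex.I) * b : ℂ) = ((-(t * b) : ℝ) : ℂ) * Complex.I by push_cast; ring,
    show (-(t * Complex.I) * a : ℂ) = ((-(t * a) : ℝ) : ℂ) * Complex.I by push_cast; ring,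
    Complex.norm_exp_ofReal_mul_I, Complex.norm_exp_ofReal_mul_I]
  norm_num

lemma integrable_smoothed_char (μ : Measure ℝ) [IsProbabilityMeasure μ] {v : ℝ≥0} (hv : v ≠ 0)
    (a b : ℝ) :
    Integrable (fun t : ℝ => charFun μ t * (∫ y in a..b, Complex.exp (-(t * y * Complex.I))) *
        (Real.exp (-(v / 2) * t ^ 2) : ℂ)) := by
  have hv0 : (0 : ℝ) < v := by positivity
  have hcont : Continuous (fun t : ℝ => ∫ y in a..b, Complex.exp (-(t * y * Complex.I))) := by
    apply intervalIntegral.continuous_parametric_intervalIntegral_of_continuous'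
    simp only [Function.uncurry_def]
    fun_prop
  have hg : Continuous (fun t : ℝ => (Real.exp (-(v / 2) * t ^ 2) : ℂ)) := by fun_prop
  refine Integrable.mono' ((integrable_exp_neg_mul_sq (b := (v : ℝ) / 2)
    (by positivity)).const_mul (|b - a|)) ?_ (Eventually.of_forall fun t => ?_)
  · exact (stronglyMeasurable_charFun.aestronglyMeasurable.mul
      hcont.aestronglyMeasurable).mul hg.aestronglyMeasurable
  · rw [norm_mul, norm_mul, Complex.norm_real, Real.norm_eq_abs, abs_of_pos (Real.exp_pos _)]
    refine mul_le_mul_of_nonneg_right ?_ (Real.exp_pos _).le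
    have h1 := norm_charFun_le_one (μ := μ) (t := t)
    have h2 : ‖∫ y in a..b, Complex.exp (-(t * y * Complex.I))‖ ≤ 1 * |b - a| := by
      refine intervalIntegral.norm_integral_le_of_norm_le_const fun y _ => ?_
      rw [show -((t : ℂ) * y * Complex.I) = ((-(t * y) : ℝ) : ℂ) * Complex.I by push_cast; ring,
        Complex.norm_exp_ofReal_mul_I]
    calc _ ≤ 1 * (1 * |b - a|) := mul_le_mul h1 h2 (norm_nonneg _) zero_le_one
      _ = _ := by ring

lemma smoothed_diff_Ioc (μ ν : Measure ℝ) [IsProbabilityMeasure μ] [IsProbabilityMeasure ν]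
    {v : ℝ≥0} (hv : v ≠ 0) (K : ℝ → ℝ) (hK : Integrable K)
    (hKb : ∀ t : ℝ, t ≠ 0 → ‖charFun μ t - charFun ν t‖ * (2 / |t|) * Real.exp (-(v / 2) * t ^ 2)
      ≤ K t) (a b : ℝ) (hab : a ≤ b) :
    |(∫ w, ((gaussianReal 0 v).real (Set.Iic (b - w))
        - (gaussianReal 0 v).real (Set.Iic (a - w))) ∂μ)
      - (∫ w, ((gaussianReal 0 v).real (Set.Iic (b - w))
        - (gaussianReal 0 v).real (Set.Iic (a - w))) ∂ν)| ≤ ∫ t, K t := by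
  rw [← Real.norm_eq_abs, ← Complex.norm_real, Complex.ofReal_sub, smoothed_fourier μ hv a b hab,
    smoothed_fourier ν hv a b hab, ← mul_sub, ← integral_sub (integrable_smoothed_char μ hv a b)
    (integrable_smoothed_char ν hv a b), norm_mul, Complex.norm_real]
  have hpi : ‖(1 / (2 * Real.pi) : ℝ)‖ ≤ 1 := by
    rw [Real.norm_eq_abs, abs_of_pos (by positivity)]
    rw [div_le_one (by positivity)]
    linarith [Real.pi_gt_three]
  refine (mul_le_of_le_one_left (norm_nonneg _) hpi).trans ?_
  refine norm_integral_le_of_norm_le hK ?_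
  have h0 : ∀ᵐ t : ℝ, t ≠ 0 := by
    simp [ae_iff]
  filter_upwards [h0] with t ht
  refine le_trans ?_ (hKb t ht)
  rw [← sub_mul, ← sub_mul, norm_mul, norm_mul, Complex.norm_real, Real.norm_eq_abs (Real.exp _),
    abs_of_pos (Real.exp_pos _)]
  gcongr
  exact norm_osc_le a b t ht

lemma cdf_shift_integrable (γ : Measure ℝ) [IsProbabilityMeasure γ]
    (μ : Measure ℝ) [IsProbabilityMeasure μ] (b : ℝ) :
    Integrable (fun w => γ.real (Set.Iic (b - w))) μ := by
  have hanti : Antitone (fun w => γ.real (Set.Iic (b - w))) := by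
    intro x y hxy
    exact measureReal_mono (Set.Iic_subset_Iic.mpr (by linarith))
  refine Integrable.of_bound hanti.measurable.aestronglyMeasurable 1
    (Eventually.of_forall fun w => ?_)
  rw [Real.norm_eq_abs, abs_of_nonneg measureReal_nonneg]
  exact measureReal_le_one

lemma cdf_shift_tendsto (γ : Measure ℝ) [IsProbabilityMeasure γ]
    (μ : Measure ℝ) [IsProbabilityMeasure μ] :
    Tendsto (fun a : ℝ => ∫ w, γ.real (Set.Iic (a - w)) ∂μ) atBot (𝓝 0) := by
  have : (0 : ℝ) = ∫ w, (0 : ℝ) ∂μ := by simp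
  rw [this]
  refine tendsto_integral_filter_of_dominated_convergence (fun _ => 1)
    (Eventually.of_forall fun a => (cdf_shift_integrable γ μ a).aestronglyMeasurable)
    (Eventually.of_forall fun a => Eventually.of_forall fun w => ?_) (integrable_const _)
    (Eventually.of_forall fun w => ?_)
  · rw [Real.norm_eq_abs, abs_of_nonneg measureReal_nonneg]
    exact measureReal_le_one
  · have h1 : Tendsto (fun x => γ.real (Set.Iic x)) atBot (𝓝 0) := by
      refine (tendsto_cdf_atBot γ).congr fun x => ?_
      rw [cdf_eq_real]
    exact h1.comp (tendsto_atBot_add_const_right _ (-w) tendsto_id)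

lemma smoothed_diff (μ ν : Measure ℝ) [IsProbabilityMeasure μ] [IsProbabilityMeasure ν]
    {v : ℝ≥0} (hv : v ≠ 0) (K : ℝ → ℝ) (hK : Integrable K)
    (hKb : ∀ t : ℝ, t ≠ 0 → ‖charFun μ t - charFun ν t‖ * (2 / |t|) * Real.exp (-(v / 2) * t ^ 2)
      ≤ K t) (b : ℝ) :
    |(∫ w, (gaussianReal 0 v).real (Set.Iic (b - w)) ∂μ)
      - (∫ w, (gaussianReal 0 v).real (Set.Iic (b - w)) ∂ν)| ≤ ∫ t, K t := by
  set γ := gaussianReal 0 v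
  have h1 : Tendsto (fun a : ℝ => |((∫ w, γ.real (Set.Iic (b - w)) ∂μ)
      - ∫ w, γ.real (Set.Iic (a - w)) ∂μ) - ((∫ w, γ.real (Set.Iic (b - w)) ∂ν)
      - ∫ w, γ.real (Set.Iic (a - w)) ∂ν)|) atBot
      (𝓝 |((∫ w, γ.real (Set.Iic (b - w)) ∂μ) - 0) - ((∫ w, γ.real (Set.Iic (b - w)) ∂ν) - 0)|) :=
    ((tendsto_const_nhds.sub (cdf_shift_tendsto γ μ)).sub
      (tendsto_const_nhds.sub (cdf_shift_tendsto γ ν))).abs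
  rw [sub_zero, sub_zero] at h1
  refine le_of_tendsto h1 ?_
  filter_upwards [eventually_le_atBot b] with a ha
  have := smoothed_diff_Ioc μ ν hv K hK hKb a b ha
  rwa [integral_sub (cdf_shift_integrable γ μ b) (cdf_shift_integrable γ μ a),
    integral_sub (cdf_shift_integrable γ ν b) (cdf_shift_integrable γ ν a)] at this

lemma gaussian_tail {v : ℝ≥0} (hv : v ≠ 0) (δ : ℝ) (hδ : 0 ≤ δ) :
    (gaussianReal 0 v).real (Set.Ici δ) ≤ Real.exp (-δ ^ 2 / (2 * v)) := by
  have hv0 : (0 : ℝ) < v := by positivity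
  have h := measure_ge_le_exp_mul_mgf (X := id) (μ := gaussianReal 0 v) (t := δ / v) δ
    (by positivity) (integrable_exp_mul_gaussianReal _)
  rw [mgf_id_gaussianReal] at h
  have e : {ω : ℝ | δ ≤ id ω} = Set.Ici δ := rfl
  rw [e] at h
  refine h.trans (le_of_eq ?_)
  simp only
  rw [← Real.exp_add]
  congr 1
  field_simp
  ring

lemma gaussian_tail_neg {v : ℝ≥0} (hv : v ≠ 0) (δ : ℝ) (hδ : 0 ≤ δ) :
    (gaussianReal 0 v).real (Set.Iic (-δ)) ≤ Real.exp (-δ ^ 2 / (2 * v)) := by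
  refine le_trans (le_of_eq ?_) (gaussian_tail hv δ hδ)
  have h := gaussianReal_map_neg (μ := 0) (v := v)
  rw [neg_zero] at h
  have h2 : ((gaussianReal 0 v).map (fun x => -x)).real (Set.Iic (-δ))
      = (gaussianReal 0 v).real (Set.Ici δ) := by
    rw [map_measureReal_apply measurable_neg measurableSet_Iic]
    congr 1
    ext x
    simp
  rw [← h2, h]

lemma cdf_le_smoothed (μ : Measure ℝ) [IsProbabilityMeasure μ] {v : ℝ≥0} (hv : v ≠ 0)
    (δ z : ℝ) (hδ : 0 ≤ δ) :
    μ.real (Set.Iic z) ≤ (∫ w, (gaussianReal 0 v).real (Set.Iic (z + δ - w)) ∂μ)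
      + Real.exp (-δ ^ 2 / (2 * v)) := by
  set γ := gaussianReal 0 v
  set η := Real.exp (-δ ^ 2 / (2 * v))
  have hη : 0 ≤ η := (Real.exp_pos _).le
  have h1 : ∫ w, (Set.Iic z).indicator (fun _ => (1 : ℝ)) w ∂μ
      ≤ ∫ w, (γ.real (Set.Iic (z + δ - w)) + η) ∂μ := by
    refine integral_mono ((integrable_const _).indicator measurableSet_Iic)
      ((cdf_shift_integrable γ μ _).add (integrable_const _)) fun w => ?_
    by_cases hw : w ∈ Set.Iic z
    · rw [Set.indicator_of_mem hw]
      have h2 : γ.real (Set.Iic δ) ≤ γ.real (Set.Iic (z + δ - w)) :=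
        measureReal_mono (Set.Iic_subset_Iic.mpr (by have : w ≤ z := hw; linarith))
      have h3 : γ.real (Set.Iic δ)ᶜ = 1 - γ.real (Set.Iic δ) :=
        probReal_compl_eq_one_sub measurableSet_Iic
      have h4 : γ.real (Set.Iic δ)ᶜ ≤ γ.real (Set.Ici δ) :=
        measureReal_mono (by rw [Set.compl_Iic]; exact Set.Ioi_subset_Ici_self)
      have h5 : γ.real (Set.Ici δ) ≤ η := gaussian_tail hv δ hδ
      simp only
      linarith
    · rw [Set.indicator_of_notMem hw]
      exact add_nonneg measureReal_nonneg hη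
  rw [integral_indicator measurableSet_Iic, integral_add (cdf_shift_integrable γ μ _)
    (integrable_const _)] at h1
  simpa using h1

lemma smoothed_le_cdf (μ : Measure ℝ) [IsProbabilityMeasure μ] {v : ℝ≥0} (hv : v ≠ 0)
    (δ z : ℝ) (hδ : 0 ≤ δ) :
    (∫ w, (gaussianReal 0 v).real (Set.Iic (z - w)) ∂μ) ≤ μ.real (Set.Iic (z + δ))
      + Real.exp (-δ ^ 2 / (2 * v)) := by
  set γ := gaussianReal 0 v
  set η := Real.exp (-δ ^ 2 / (2 * v))
  have hη : 0 ≤ η := (Real.exp_pos _).le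
  have h1 : ∫ w, γ.real (Set.Iic (z - w)) ∂μ ≤
      ∫ w, ((Set.Iic (z + δ)).indicator (fun _ => (1 : ℝ)) w + η) ∂μ := by
    refine integral_mono (cdf_shift_integrable γ μ _)
      (((integrable_const _).indicator measurableSet_Iic).add (integrable_const _)) fun w => ?_
    by_cases hw : w ∈ Set.Iic (z + δ)
    · simp only [Set.indicator_of_mem hw]
      have : γ.real (Set.Iic (z - w)) ≤ 1 := measureReal_le_one
      linarith
    · simp only [Set.indicator_of_notMem hw]
      have h2 : γ.real (Set.Iic (z - w)) ≤ γ.real (Set.Iic (-δ)) :=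
        measureReal_mono (Set.Iic_subset_Iic.mpr (by
          have : z + δ < w := not_le.mp hw
          linarith))
      have h5 : γ.real (Set.Iic (-δ)) ≤ η := gaussian_tail_neg hv δ hδ
      linarith
  rw [integral_add ((integrable_const _).indicator measurableSet_Iic) (integrable_const _),
    integral_indicator measurableSet_Iic] at h1
  simpa using h1

lemma cdf_compare (μ ν : Measure ℝ) [IsProbabilityMeasure μ] [IsProbabilityMeasure ν]
    {v : ℝ≥0} (hv : v ≠ 0) (K : ℝ → ℝ) (hK : Integrable K)
    (hKb : ∀ t : ℝ, t ≠ 0 → ‖charFun μ t - charFun ν t‖ * (2 / |t|) * Real.exp (-(v / 2) * t ^ 2)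
      ≤ K t) (z δ : ℝ) (hδ : 0 ≤ δ) :
    μ.real (Set.Iic z) ≤ ν.real (Set.Iic (z + 2 * δ)) + 2 * Real.exp (-δ ^ 2 / (2 * v))
      + ∫ t, K t := by
  have h1 := cdf_le_smoothed μ hv δ z hδ
  have h2 := smoothed_le_cdf ν hv δ (z + δ) hδ
  have h3 := (abs_le.mp (smoothed_diff μ ν hv K hK hKb (z + δ))).2
  rw [show z + δ + δ = z + 2 * δ by ring] at h2
  linarith

end Fourier

section CharEst
open ProbabilityTheory Filter Topology
open scoped NNReal

noncomputable def discMeas {ι : Type*} [Fintype ι] (P W : ι → ℝ) : Measure ℝ :=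
  ∑ x, ENNReal.ofReal (P x) • Measure.dirac (W x)

lemma discMeas_prob {ι : Type*} [Fintype ι] (P W : ι → ℝ) (hP : ∀ x, 0 ≤ P x)
    (hPs : ∑ x, P x = 1) : IsProbabilityMeasure (discMeas P W) := by
  constructor
  simp only [discMeas, Measure.coe_finsetSum, Finset.sum_apply, Measure.smul_apply, measure_univ,
    smul_eq_mul, mul_one]
  rw [← ENNReal.ofReal_sum_of_nonneg (fun x _ => hP x), hPs, ENNReal.ofReal_one]

lemma discMeas_charFun {ι : Type*} [Fintype ι] (P W : ι → ℝ) (hP : ∀ x, 0 ≤ P x) (t : ℝ) :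
    charFun (discMeas P W) t = ∑ x, (P x : ℂ) * Complex.exp (t * W x * Complex.I) := by
  rw [charFun_apply_real, discMeas, integral_finsetSum_measure]
  · refine Finset.sum_congr rfl fun x _ => ?_
    rw [integral_smul_measure, integral_dirac, ENNReal.toReal_ofReal (hP x)]
    simp
  · intro x _
    refine Integrable.smul_measure ?_ ENNReal.ofReal_ne_top
    exact integrable_dirac (by simp)

lemma discMeas_cdf {ι : Type*} [Fintype ι] (P W : ι → ℝ) (hP : ∀ x, 0 ≤ P x) (z : ℝ) :
    (discMeas P W).real (Set.Iic z) = ∑ x ∈ Finset.univ.filter (fun x => W x ≤ z), P x := by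
  rw [Measure.real, discMeas]
  simp only [Measure.coe_finsetSum, Finset.sum_apply, Measure.smul_apply, smul_eq_mul,
    Measure.dirac_apply]
  rw [ENNReal.toReal_sum, Finset.sum_filter]
  · refine Finset.sum_congr rfl fun x _ => ?_
    by_cases h : W x ≤ z
    · simp [h, hP x]
    · simp [h]
  · intro x _
    exact ENNReal.mul_ne_top ENNReal.ofReal_ne_top (by
      by_cases h : W x ∈ Set.Iic z <;> simp [Set.indicator, h])

lemma norm_pow_diff_le (x y : ℂ) (M : ℝ) (hx : ‖x‖ ≤ M) (hy : ‖y‖ ≤ M) (n : ℕ) :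
    ‖x ^ (n + 1) - y ^ (n + 1)‖ ≤ (n + 1) * ‖x - y‖ * M ^ n := by
  have hM : 0 ≤ M := (norm_nonneg x).trans hx
  induction n with
  | zero => simp
  | succ k ih =>
    have e : x ^ (k + 1 + 1) - y ^ (k + 1 + 1)
        = (x ^ (k + 1) - y ^ (k + 1)) * x + y ^ (k + 1) * (x - y) := by ring
    rw [e]
    calc _ ≤ ‖x ^ (k + 1) - y ^ (k + 1)‖ * ‖x‖ + ‖y‖ ^ (k + 1) * ‖x - y‖ := by
          refine (norm_add_le _ _).trans ?_
          rw [norm_mul, norm_mul, norm_pow]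
      _ ≤ ((k + 1) * ‖x - y‖ * M ^ k) * M + M ^ (k + 1) * ‖x - y‖ := by gcongr
      _ = _ := by push_cast; ring

variable {α : Type*} [Fintype α]

lemma char_taylor (p Y : α → ℝ) (hp : ∀ x, 0 ≤ p x) (hps : ∑ x, p x = 1)
    (h1 : ∑ x, p x * Y x = 0) (h2 : ∑ x, p x * Y x ^ 2 = 1) (B : ℝ) (hB : 1 ≤ B)
    (hY : ∀ x, |Y x| ≤ B) (s : ℝ) (hs : |s| * B ≤ 1) :
    ‖(∑ x, (p x : ℂ) * Complex.exp (s * Y x * Complex.I)) - (1 - s ^ 2 / 2 : ℝ)‖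
      ≤ B ^ 3 * |s| ^ 3 := by
  have e1 : ((1 - s ^ 2 / 2 : ℝ) : ℂ) = ∑ x, (p x : ℂ) *
      (∑ m ∈ Finset.range 3, (s * Y x * Complex.I) ^ m / (m.factorial : ℂ)) := by
    have : ∀ x, (p x : ℂ) * (∑ m ∈ Finset.range 3, (s * Y x * Complex.I) ^ m / (m.factorial : ℂ))
        = ((p x : ℝ) : ℂ) + ((p x * Y x : ℝ) : ℂ) * (s * Complex.I)
          - ((p x * Y x ^ 2 : ℝ) : ℂ) * (s ^ 2 / 2) := by
      intro x
      simp only [Finset.sum_range_succ, Finset.sum_range_zero, Nat.factorial]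
      push_cast
      have := Complex.I_sq
      ring_nf
      rw [this]
      ring
    simp_rw [this]
    rw [Finset.sum_sub_distrib, Finset.sum_add_distrib, ← Finset.sum_mul, ← Finset.sum_mul,
      ← Complex.ofReal_sum, ← Complex.ofReal_sum, ← Complex.ofReal_sum, hps, h1, h2]
    push_cast
    ring
  rw [e1, ← Finset.sum_sub_distrib]
  calc _ ≤ ∑ x, ‖(p x : ℂ) * Complex.exp (s * Y x * Complex.I) - (p x : ℂ) *
      (∑ m ∈ Finset.range 3, (s * Y x * Complex.I) ^ m / (m.factorial : ℂ))‖ := norm_sum_le _ _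
    _ ≤ ∑ x, p x * (B ^ 3 * |s| ^ 3) := by
      refine Finset.sum_le_sum fun x _ => ?_
      rw [← mul_sub, norm_mul, Complex.norm_real, Real.norm_eq_abs, abs_of_nonneg (hp x)]
      refine mul_le_mul_of_nonneg_left ?_ (hp x)
      have hn : ‖(s * Y x * Complex.I : ℂ)‖ = |s| * |Y x| := by simp
      have hle : |s| * |Y x| ≤ |s| * B := mul_le_mul_of_nonneg_left (hY x) (abs_nonneg _)
      refine (Complex.exp_bound (by rw [hn]; linarith) (n := 3) (by norm_num)).trans ?_
      rw [hn]
      calc _ ≤ (|s| * B) ^ 3 * 1 := by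
            refine mul_le_mul (pow_le_pow_left₀ (by positivity) hle 3) ?_ (by positivity) (by positivity)
            norm_num [Nat.factorial]
        _ = _ := by ring
    _ = _ := by rw [← Finset.sum_mul, hps, one_mul]

lemma char_small (p Y : α → ℝ) (hp : ∀ x, 0 ≤ p x) (hps : ∑ x, p x = 1)
    (h1 : ∑ x, p x * Y x = 0) (h2 : ∑ x, p x * Y x ^ 2 = 1) (B : ℝ) (hB : 1 ≤ B)
    (hY : ∀ x, |Y x| ≤ B) (s : ℝ) (hs : |s| ≤ 1 / (4 * B ^ 3)) (n : ℕ) :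
    ‖(∑ x, (p x : ℂ) * Complex.exp (s * Y x * Complex.I)) ^ (n + 1)
        - ((Real.exp (-s ^ 2 / 2) : ℝ) : ℂ) ^ (n + 1)‖
      ≤ (n + 1) * (2 * B ^ 3 * |s| ^ 3) * Real.exp (-s ^ 2 / 4) ^ n := by
  have hB3 : 1 ≤ B ^ 3 := one_le_pow₀ hB
  have hBB : B ≤ B ^ 3 := le_self_pow₀ hB (by norm_num)
  have hsB3 : |s| * B ^ 3 ≤ 1 / 4 := by
    rw [le_div_iff₀ (by positivity)] at hs
    linarith
  have hs0 := abs_nonneg s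
  have hs1 : |s| ≤ 1 / 4 := by nlinarith
  have hsB : |s| * B ≤ 1 := by nlinarith
  have hss : s ^ 2 = |s| ^ 2 := (sq_abs s).symm
  have ht := char_taylor p Y hp hps h1 h2 B hB hY s hsB
  set φ := ∑ x, (p x : ℂ) * Complex.exp (s * Y x * Complex.I)
  have hcube : B ^ 3 * |s| ^ 3 ≤ s ^ 2 / 4 := by
    rw [hss]; nlinarith [sq_nonneg |s|]
  have hφ : ‖φ‖ ≤ Real.exp (-s ^ 2 / 4) := by
    have : ‖φ‖ ≤ ‖φ - (1 - s ^ 2 / 2 : ℝ)‖ + ‖((1 - s ^ 2 / 2 : ℝ) : ℂ)‖ := by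
      have h := norm_add_le (φ - (1 - s ^ 2 / 2 : ℝ)) ((1 - s ^ 2 / 2 : ℝ) : ℂ)
      rwa [sub_add_cancel] at h
    rw [Complex.norm_real, Real.norm_eq_abs, abs_of_nonneg (by rw [hss]; nlinarith)] at this
    have h3 := Real.add_one_le_exp (-s ^ 2 / 4)
    linarith
  have hg : ‖((Real.exp (-s ^ 2 / 2) : ℝ) : ℂ)‖ ≤ Real.exp (-s ^ 2 / 4) := by
    rw [Complex.norm_real, Real.norm_eq_abs, abs_of_pos (Real.exp_pos _)]
    exact Real.exp_le_exp.mpr (by nlinarith [sq_nonneg s])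
  have hd : ‖φ - ((Real.exp (-s ^ 2 / 2) : ℝ) : ℂ)‖ ≤ 2 * B ^ 3 * |s| ^ 3 := by
    have h4 : |Real.exp (-s ^ 2 / 2) - 1 - (-s ^ 2 / 2)| ≤ (-s ^ 2 / 2) ^ 2 := by
      apply Real.abs_exp_sub_one_sub_id_le
      rw [abs_le]; constructor <;> (rw [hss]; nlinarith)
    have h5 : (-s ^ 2 / 2) ^ 2 ≤ B ^ 3 * |s| ^ 3 := by
      rw [hss]
      have : (-|s| ^ 2 / 2) ^ 2 = |s| ^ 3 * (|s| / 4) := by ring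
      rw [this, mul_comm (B ^ 3)]
      exact mul_le_mul_of_nonneg_left (by linarith) (by positivity)
    have h6 : ‖(((1 - s ^ 2 / 2 : ℝ) : ℂ)) - ((Real.exp (-s ^ 2 / 2) : ℝ) : ℂ)‖
        ≤ B ^ 3 * |s| ^ 3 := by
      rw [← Complex.ofReal_sub, Complex.norm_real, Real.norm_eq_abs, abs_sub_comm]
      refine le_trans (le_of_eq ?_) (h4.trans h5)
      congr 1
      ring
    have h7 := norm_add_le (φ - ((1 - s ^ 2 / 2 : ℝ) : ℂ))
      (((1 - s ^ 2 / 2 : ℝ) : ℂ) - ((Real.exp (-s ^ 2 / 2) : ℝ) : ℂ))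
    rw [sub_add_sub_cancel] at h7
    linarith
  refine (norm_pow_diff_le _ _ _ hφ hg n).trans ?_
  gcongr

lemma char_small' (p Y : α → ℝ) (hp : ∀ x, 0 ≤ p x) (hps : ∑ x, p x = 1)
    (h1 : ∑ x, p x * Y x = 0) (h2 : ∑ x, p x * Y x ^ 2 = 1) (B : ℝ) (hB : 1 ≤ B)
    (hY : ∀ x, |Y x| ≤ B) (n : ℕ) (hn : 2 ≤ n) (t : ℝ)
    (ht : |t| ≤ 1 / (4 * B ^ 3) * Real.sqrt n) :
    ‖(∑ x, (p x : ℂ) * Complex.exp ((t / Real.sqrt n : ℝ) * Y x * Complex.I)) ^ n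
        - ((Real.exp (-t ^ 2 / 2) : ℝ) : ℂ)‖
      ≤ 2 * B ^ 3 / Real.sqrt n * |t| ^ 3 * Real.exp (-(1 / 8) * t ^ 2) := by
  obtain ⟨k, rfl⟩ : ∃ k, n = k + 1 := ⟨n - 1, by omega⟩
  have hn0 : (0 : ℝ) < ((k + 1 : ℕ) : ℝ) := by positivity
  set r := Real.sqrt ((k + 1 : ℕ) : ℝ) with hr
  have hr0 : 0 < r := Real.sqrt_pos.mpr hn0
  have hrr : r ^ 2 = ((k + 1 : ℕ) : ℝ) := Real.sq_sqrt hn0.le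
  have hs : |t / r| ≤ 1 / (4 * B ^ 3) := by
    rw [abs_div, abs_of_pos hr0, div_le_iff₀ hr0]
    exact ht
  have h := char_small p Y hp hps h1 h2 B hB hY (t / r) hs k
  have e1 : ((Real.exp (-(t / r) ^ 2 / 2) : ℝ) : ℂ) ^ (k + 1) = ((Real.exp (-t ^ 2 / 2) : ℝ) : ℂ) := by
    rw [← Complex.ofReal_pow, ← Real.exp_nat_mul, ← hrr]
    congr 2
    field_simp
  rw [e1] at h
  refine h.trans ?_
  have hk : (1 : ℝ) ≤ k := by exact_mod_cast (by omega : 1 ≤ k)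
  have e2 : Real.exp (-(t / r) ^ 2 / 4) ^ k ≤ Real.exp (-(1 / 8) * t ^ 2) := by
    rw [← Real.exp_nat_mul]
    apply Real.exp_le_exp.mpr
    rw [div_pow, hrr]
    push_cast
    have : (1 : ℝ) / 2 ≤ k / (k + 1) := by
      rw [div_le_div_iff₀ (by norm_num) (by positivity)]
      linarith
    have h3 : (k : ℝ) * (-(t ^ 2 / (k + 1)) / 4) = -(t ^ 2 / 4) * (k / (k + 1)) := by
      field_simp
    rw [h3]
    nlinarith [sq_nonneg t]
  have e3 : ((k : ℝ) + 1) * (2 * B ^ 3 * |t / r| ^ 3) = 2 * B ^ 3 / r * |t| ^ 3 := by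
    rw [abs_div, abs_of_pos hr0, div_pow]
    have : (k : ℝ) + 1 = r ^ 2 := by rw [hrr]; push_cast; ring
    rw [this]
    field_simp
  rw [e3]
  have : 0 ≤ B := by linarith
  gcongr

lemma iid_charFun (p Y : α → ℝ) (hp : ∀ x, 0 ≤ p x) (n : ℕ) (t : ℝ) :
    charFun (discMeas (fun x : Fin n → α => ∏ j, p (x j))
      (fun x => (∑ j, Y (x j)) / Real.sqrt n)) t
    = (∑ x, (p x : ℂ) * Complex.exp ((t / Real.sqrt n : ℝ) * Y x * Complex.I)) ^ n := by
  classical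
  rw [discMeas_charFun _ _ (fun x => Finset.prod_nonneg fun j _ => hp _), Fintype.sum_pow]
  refine Finset.sum_congr rfl fun x _ => ?_
  rw [Finset.prod_mul_distrib, ← Complex.exp_sum]
  push_cast
  congr 2
  rw [← Finset.sum_mul, ← Finset.mul_sum]
  ring

lemma gaussian_cdf_lip (z u : ℝ) (hu : 0 ≤ u) :
    (gaussianReal 0 1).real (Set.Iic (z + u)) ≤ (gaussianReal 0 1).real (Set.Iic z) + u := by
  have hb : ∀ x, gaussianPDFReal 0 1 x ≤ 1 := by
    intro x
    rw [gaussianPDFReal_def]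
    refine mul_le_one₀ ?_ (Real.exp_pos _).le (Real.exp_le_one_iff.mpr ?_)
    · refine inv_le_one_of_one_le₀ (Real.one_le_sqrt.mpr ?_)
      have := Real.pi_gt_three
      simp
      linarith
    · exact div_nonpos_of_nonpos_of_nonneg (by nlinarith [sq_nonneg (x - 0)]) (by positivity)
  have h := gaussian_cdf_sub (v := 1) one_ne_zero z (z + u) 0
  simp only [sub_zero] at h
  have h2 : ∫ y in z..(z + u), gaussianPDFReal 0 1 y ≤ ∫ y in z..(z + u), (1 : ℝ) := by
    refine intervalIntegral.integral_mono_on (by linarith)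
      (integrable_gaussianPDFReal 0 1).intervalIntegrable (by simp) fun x _ => hb x
  simp at h2
  linarith

lemma berry_esseen (p Y : α → ℝ) (hp : ∀ x, 0 ≤ p x) (hps : ∑ x, p x = 1)
    (h1 : ∑ x, p x * Y x = 0) (h2 : ∑ x, p x * Y x ^ 2 = 1) :
    ∃ C : ℝ, 0 < C ∧ ∀ n : ℕ, 3 ≤ n → ∀ z : ℝ,
      |(∑ x ∈ Finset.univ.filter (fun x : Fin n → α => (∑ j, Y (x j)) / Real.sqrt n ≤ z),
        ∏ j, p (x j)) - (gaussianReal 0 1).real (Set.Iic z)| ≤ C * (Real.log n / Real.sqrt n) := by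
  classical
  obtain ⟨B, hB, hY⟩ : ∃ B : ℝ, 1 ≤ B ∧ ∀ x, |Y x| ≤ B := by
    refine ⟨1 + ∑ x, |Y x|, by linarith [Finset.sum_nonneg fun x (_ : x ∈ Finset.univ) => abs_nonneg (Y x)], fun x => ?_⟩
    have := Finset.single_le_sum (f := fun x => |Y x|) (fun x _ => abs_nonneg _) (Finset.mem_univ x)
    linarith
  set c : ℝ := 1 / (4 * B ^ 3) with hc
  have hc0 : 0 < c := by positivity
  have hI : Integrable (fun t : ℝ => t ^ 2 * Real.exp (-(1 / 8) * t ^ 2)) := by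
    have := integrable_rpow_mul_exp_neg_mul_sq (b := 1 / 8) (by norm_num) (s := 2) (by norm_num)
    simpa using this
  set M : ℝ := ∫ t : ℝ, t ^ 2 * Real.exp (-(1 / 8) * t ^ 2) with hM
  have hM0 : 0 ≤ M := integral_nonneg fun t => by positivity
  refine ⟨4 / c + 2 + 4 * B ^ 3 * M + 16, by positivity, fun n hn z => ?_⟩
  have hn0 : (0 : ℝ) < n := by positivity
  set L := Real.log n with hL
  have hL1 : 1 ≤ L := by
    rw [hL, Real.le_log_iff_exp_le hn0]
    have : (3 : ℝ) ≤ n := by exact_mod_cast hn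
    linarith [Real.exp_one_lt_d9]
  set r := Real.sqrt n with hr
  have hr0 : 0 < r := Real.sqrt_pos.mpr hn0
  have hrr : r ^ 2 = n := Real.sq_sqrt hn0.le
  set v : ℝ≥0 := ⟨2 * L / (c ^ 2 * n), by positivity⟩ with hvdef
  have hvv : (v : ℝ) = 2 * L / (c ^ 2 * n) := rfl
  have hv0 : (0 : ℝ) < v := by rw [hvv]; positivity
  have hv : v ≠ 0 := by
    intro h
    rw [h] at hv0
    simp at hv0
  set P : (Fin n → α) → ℝ := fun x => ∏ j, p (x j) with hP
  set W : (Fin n → α) → ℝ := fun x => (∑ j, Y (x j)) / r with hW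
  have hP0 : ∀ x, 0 ≤ P x := fun x => Finset.prod_nonneg fun j _ => hp _
  have hPs : ∑ x, P x = 1 := by
    rw [hP, ← Fintype.sum_pow, hps, one_pow]
  set μ := discMeas P W with hμ
  haveI : IsProbabilityMeasure μ := discMeas_prob P W hP0 hPs
  set ν := gaussianReal 0 1 with hν
  have hexpL : Real.exp (-(L / 2)) = 1 / r := by
    rw [hr, Real.sqrt_eq_rpow, Real.rpow_def_of_pos hn0, one_div, ← Real.exp_neg]
    congr 1
    ring
  set K1 : ℝ → ℝ := fun t => 4 * B ^ 3 / r * (t ^ 2 * Real.exp (-(1 / 8) * t ^ 2)) with hK1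
  set K2 : ℝ → ℝ := fun t => 4 / (c * r) * (1 / r) * Real.exp (-(v / 4) * t ^ 2) with hK2
  have hK1i : Integrable K1 := hI.const_mul _
  have hK2i : Integrable K2 := (integrable_exp_neg_mul_sq (by positivity)).const_mul _
  have hK1n : ∀ t, 0 ≤ K1 t := fun t => by
    have : 0 ≤ B := by linarith
    simp only [hK1]; positivity
  have hK2n : ∀ t, 0 ≤ K2 t := fun t => by simp only [hK2]; positivity
  have hνc : ∀ t : ℝ, charFun ν t = ((Real.exp (-t ^ 2 / 2) : ℝ) : ℂ) := by
    intro t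
    rw [hν, charFun_gaussianReal]
    push_cast
    congr 1
    simp
    ring
  have hKb : ∀ t : ℝ, t ≠ 0 →
      ‖charFun μ t - charFun ν t‖ * (2 / |t|) * Real.exp (-(v / 2) * t ^ 2) ≤ K1 t + K2 t := by
    intro t ht
    have ht0 : 0 < |t| := abs_pos.mpr ht
    by_cases hts : |t| ≤ c * r
    · have h3 := char_small' p Y hp hps h1 h2 B hB hY n (by omega) t hts
      rw [← iid_charFun p Y hp n t] at h3
      have hexp : Real.exp (-(v / 2) * t ^ 2) ≤ 1 := by
        apply Real.exp_le_one_iff.mpr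
        nlinarith [sq_nonneg t]
      rw [hνc]
      calc _ ≤ (2 * B ^ 3 / r * |t| ^ 3 * Real.exp (-(1 / 8) * t ^ 2)) * (2 / |t|) * 1 := by
            gcongr
        _ = K1 t := by
            simp only [hK1]
            rw [← sq_abs t]
            field_simp
            ring
        _ ≤ _ := by linarith [hK2n t]
    · push Not at hts
      have h3 : ‖charFun μ t - charFun ν t‖ ≤ 2 := by
        refine (norm_sub_le _ _).trans ?_
        have ha := norm_charFun_le_one (μ := μ) (t := t)
        have hb := norm_charFun_le_one (μ := ν) (t := t)
        linarith
      have h4 : Real.exp (-(v / 2) * t ^ 2) ≤ 1 / r * Real.exp (-(v / 4) * t ^ 2) := by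
        rw [← hexpL, ← Real.exp_add]
        apply Real.exp_le_exp.mpr
        have h5 : (c * r) ^ 2 ≤ t ^ 2 := by
          rw [← sq_abs t]
          gcongr
        have h6 : (v : ℝ) * (c * r) ^ 2 = 2 * L := by
          rw [hvv, mul_pow, hrr]
          field_simp
        nlinarith [mul_le_mul_of_nonneg_left h5 hv0.le]
      calc _ ≤ 2 * (2 / (c * r)) * (1 / r * Real.exp (-(v / 4) * t ^ 2)) := by
            gcongr
        _ = K2 t := by
            simp only [hK2]
            ring
        _ ≤ _ := by linarith [hK1n t]
  have hInteg : ∫ t, (K1 t + K2 t) ≤ (4 * B ^ 3 * M + 16) / r := by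
    rw [integral_add hK1i hK2i]
    have i1 : ∫ t, K1 t = 4 * B ^ 3 * M / r := by
      simp only [hK1]
      rw [integral_const_mul, ← hM]
      ring
    have i2 : ∫ t, K2 t ≤ 16 / r := by
      simp only [hK2]
      rw [integral_const_mul, integral_gaussian]
      have h5 : Real.sqrt (Real.pi / (v / 4)) ≤ 4 * (c * r) := by
        rw [Real.sqrt_le_iff]
        refine ⟨by positivity, ?_⟩
        rw [hvv, mul_pow, mul_pow, hrr]
        have : Real.pi / (2 * L / (c ^ 2 * n) / 4) = (2 * Real.pi / L) * (c ^ 2 * n) := by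
          field_simp
          ring
        rw [this]
        refine mul_le_mul_of_nonneg_right ?_ (by positivity)
        rw [div_le_iff₀ (by linarith)]
        nlinarith [Real.pi_lt_four]
      calc _ ≤ 4 / (c * r) * (1 / r) * (4 * (c * r)) := by gcongr
        _ = 16 / r := by field_simp; norm_num
    rw [i1]
    calc _ ≤ 4 * B ^ 3 * M / r + 16 / r := by linarith
      _ = _ := by ring
  set δ : ℝ := 2 * L / (c * r) with hδ
  have hδ0 : 0 ≤ δ := by positivity
  have hη : Real.exp (-δ ^ 2 / (2 * v)) ≤ 1 / r := by
    rw [← hexpL]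
    apply Real.exp_le_exp.mpr
    have : -δ ^ 2 / (2 * v) = -L := by
      rw [hδ, hvv, div_pow, mul_pow c, hrr]
      field_simp
    rw [this]
    linarith
  have hKb' : ∀ t : ℝ, t ≠ 0 →
      ‖charFun ν t - charFun μ t‖ * (2 / |t|) * Real.exp (-(v / 2) * t ^ 2) ≤ K1 t + K2 t := by
    intro t ht
    rw [norm_sub_rev]
    exact hKb t ht
  have c1 := cdf_compare μ ν hv _ (hK1i.add hK2i) hKb z δ hδ0
  have c2 := cdf_compare ν μ hv _ (hK1i.add hK2i) hKb' (z - 2 * δ) δ hδ0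
  rw [sub_add_cancel] at c2
  have l1 := gaussian_cdf_lip z (2 * δ) (by positivity)
  have l2 := gaussian_cdf_lip (z - 2 * δ) (2 * δ) (by positivity)
  rw [sub_add_cancel] at l2
  have hcdf := discMeas_cdf P W hP0 z
  simp only [Pi.add_apply] at c1 c2
  rw [← hcdf]
  have hfin : 2 * δ + 2 * (1 / r) + (4 * B ^ 3 * M + 16) / r
      ≤ (4 / c + 2 + 4 * B ^ 3 * M + 16) * (L / r) := by
    have e1 : 2 * δ + 2 * (1 / r) + (4 * B ^ 3 * M + 16) / r
      = (4 / c * L + 2 + 4 * B ^ 3 * M + 16) / r := by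
      rw [hδ]
      field_simp
      ring
    have e2 : (4 / c + 2 + 4 * B ^ 3 * M + 16) * (L / r)
      = (4 / c * L + (2 + 4 * B ^ 3 * M + 16) * L) / r := by ring
    rw [e1, e2]
    have : 2 + 4 * B ^ 3 * M + 16 ≤ (2 + 4 * B ^ 3 * M + 16) * L :=
      le_mul_of_one_le_right (by positivity) hL1
    exact div_le_div_of_nonneg_right (by linarith) hr0.le
  rw [abs_le]
  constructor <;> linarith

end CharEst

section Final
open ProbabilityTheory Filter Topology
open scoped NNReal

lemma phi_lower (a b R : ℝ) (hab : a ≤ b) (ha : |a| ≤ R) (hb : |b| ≤ R) :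
    gaussianPDFReal 0 1 R * (b - a) ≤
      (gaussianReal 0 1).real (Set.Iic b) - (gaussianReal 0 1).real (Set.Iic a) := by
  have h := gaussian_cdf_sub (v := 1) one_ne_zero a b 0
  simp only [sub_zero] at h
  rw [h]
  have hc : gaussianPDFReal 0 1 R * (b - a) = ∫ _ in a..b, gaussianPDFReal 0 1 R := by
    rw [intervalIntegral.integral_const, smul_eq_mul, mul_comm]
  rw [hc]
  refine intervalIntegral.integral_mono_on hab (by simp)
    (integrable_gaussianPDFReal 0 1).intervalIntegrable fun x hx => ?_
  rw [gaussianPDFReal_def]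
  have hx' : |x| ≤ R := abs_le.mpr ⟨by linarith [(abs_le.mp ha).1, hx.1], by
    linarith [(abs_le.mp hb).2, hx.2]⟩
  have : x ^ 2 ≤ R ^ 2 := sq_le_sq' (abs_le.mp hx').1 (abs_le.mp hx').2
  simp only [sub_zero, NNReal.coe_one, mul_one]
  gcongr

lemma phi_strictMono : StrictMono fun z => (gaussianReal 0 1).real (Set.Iic z) := by
  intro a b hab
  have h := phi_lower a b (max |a| |b|) hab.le (le_max_left _ _) (le_max_right _ _)
  have h2 : 0 < gaussianPDFReal 0 1 (max |a| |b|) := gaussianPDFReal_pos _ _ _ one_ne_zero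
  have := mul_pos h2 (sub_pos.mpr hab)
  simp only
  linarith

lemma phi_continuous : Continuous fun z => (gaussianReal 0 1).real (Set.Iic z) := by
  have : LipschitzWith 1 fun z => (gaussianReal 0 1).real (Set.Iic z) := by
    refine LipschitzWith.of_le_add fun x y => ?_
    rcases le_total x y with h | h
    · have := phi_strictMono.monotone h
      linarith [dist_nonneg (x := x) (y := y)]
    · have := gaussian_cdf_lip y (x - y) (by linarith)
      rw [Real.dist_eq, abs_of_nonneg (by linarith)]
      simpa using this
  exact this.continuous

lemma phi_eq (z : ℝ) : (1 / Real.sqrt (2 * Real.pi)) *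
    (∫ t in Set.Iic z, Real.exp (-t ^ 2 / 2)) = (gaussianReal 0 1).real (Set.Iic z) := by
  rw [gaussian_cdf_eq one_ne_zero, ← integral_const_mul]
  congr 1
  ext t
  simp [gaussianPDFReal_def]

lemma phiInv_spec (q : ℝ) (hq0 : 0 < q) (hq1 : q < 1) :
    ∃ m : ℝ, 0 < m ∧ ∀ u : ℝ, 0 ≤ u → u ≤ 1 →
      q + m * u ≤ (gaussianReal 0 1).real (Set.Iic (PhiInv q + u)) ∧
      (gaussianReal 0 1).real (Set.Iic (PhiInv q - u)) ≤ q - m * u := by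
  set F : ℝ → ℝ := fun z => (gaussianReal 0 1).real (Set.Iic z) with hF
  have hbot : Tendsto F atBot (𝓝 0) := by
    have := tendsto_cdf_atBot (gaussianReal 0 1)
    refine this.congr fun x => ?_
    rw [cdf_eq_real]
  have htop : Tendsto F atTop (𝓝 1) := by
    have := tendsto_cdf_atTop (gaussianReal 0 1)
    refine this.congr fun x => ?_
    rw [cdf_eq_real]
  obtain ⟨a, ha⟩ := (hbot.eventually_lt_const hq0).exists
  obtain ⟨b, hb⟩ := (htop.eventually_const_lt hq1).exists
  obtain ⟨z, hz⟩ : ∃ z, F z = q := by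
    have := mem_range_of_exists_le_of_exists_ge phi_continuous ⟨a, ha.le⟩ ⟨b, hb.le⟩
    exact this
  have hset : PhiInv q = z := by
    rw [PhiInv]
    have : {z : ℝ | (1 / Real.sqrt (2 * Real.pi)) *
        (∫ t in Set.Iic z, Real.exp (-t ^ 2 / 2)) ≤ q} = Set.Iic z := by
      ext y
      rw [Set.mem_ofPred_eq, phi_eq, Set.mem_Iic, ← hz]
      exact phi_strictMono.le_iff_le
    rw [this, csSup_Iic]
  rw [hset]
  refine ⟨gaussianPDFReal 0 1 (|z| + 1), gaussianPDFReal_pos _ _ _ one_ne_zero,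
    fun u hu0 hu1 => ⟨?_, ?_⟩⟩
  · have := phi_lower z (z + u) (|z| + 1) (by linarith) (by linarith) ((abs_add_le _ _).trans (by
      rw [abs_of_nonneg hu0]; linarith))
    simp only [hF] at hz
    rw [hz] at this
    rw [add_sub_cancel_left] at this
    linarith
  · have := phi_lower (z - u) z (|z| + 1) (by linarith) ((abs_sub _ _).trans (by
      rw [abs_of_nonneg hu0]; linarith)) (by linarith)
    simp only [hF] at hz
    rw [hz] at this
    rw [sub_sub_cancel] at this
    linarith

lemma logdiv_tendsto : Tendsto (fun n : ℕ => Real.log n / Real.sqrt n) atTop (𝓝 0) := by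
  have h := (isLittleO_log_rpow_atTop (r := 1 / 2) (by norm_num)).tendsto_div_nhds_zero
  have := h.comp tendsto_natCast_atTop_atTop
  refine this.congr fun n => ?_
  simp [Real.sqrt_eq_rpow]

variable {d : ℕ}

lemma prodDist_nonneg (p : Fin d → ℝ) (hp : ∀ x, 0 ≤ p x) (n : ℕ) (x) : 0 ≤ prodDist p n x :=
  Finset.prod_nonneg fun _ _ => hp _

lemma prodDist_sum (p : Fin d → ℝ) (hps : ∑ x, p x = 1) (n : ℕ) : ∑ x, prodDist p n x = 1 := by
  unfold prodDist
  rw [← Fintype.piFinset_univ, ← Finset.prod_univ_sum]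
  simp [hps]

lemma logb_prodDist (p : Fin d → ℝ) (hp : ∀ x, 0 ≤ p x) (n : ℕ) (x : Fin n → Fin d)
    (h : 0 < prodDist p n x) : Real.logb 2 (prodDist p n x) = ∑ j, Real.logb 2 (p (x j)) := by
  unfold prodDist at *
  rw [Real.logb_prod]
  intro j hj h0
  exact h.ne' (Finset.prod_eq_zero hj h0)

lemma classical_case_zero (p : Fin d → ℝ) (hp : ∀ x, 0 ≤ p x) (hps : ∑ x, p x = 1)
    (q z0 H : ℝ) (hq0 : 0 < q) (hq1 : q < 1)
    (hW : ∀ x, 0 < p x → Real.logb 2 (p x) = -H) :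
    ∃ C : ℝ, 0 < C ∧ ∃ N : ℕ, ∀ n : ℕ, N ≤ n → 2 ≤ n →
      (q ≤ ∑ x ∈ univ.filter (fun x => (2 : ℝ) ^ (-((n * H + Real.sqrt (n * 0) * z0)
        + C * Real.logb 2 n)) ≤ prodDist p n x), prodDist p n x) ∧
      (∑ x ∈ univ.filter (fun x => (2 : ℝ) ^ (-((n * H + Real.sqrt (n * 0) * z0)
        - C * Real.logb 2 n)) < prodDist p n x), prodDist p n x < q - 1 / Real.sqrt n) := by
  have hlim : Tendsto (fun n : ℕ => 1 / Real.sqrt n) atTop (𝓝 0) := by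
    have := (tendsto_inv_atTop_zero.comp (Real.tendsto_sqrt_atTop)).comp
      (tendsto_natCast_atTop_atTop (R := ℝ))
    refine this.congr fun n => ?_
    simp
  obtain ⟨N, hN⟩ := eventually_atTop.mp (hlim.eventually_lt_const hq0)
  refine ⟨1, one_pos, N, fun n hn hn2 => ?_⟩
  have hL : 0 < Real.logb 2 n := Real.logb_pos (by norm_num) (by exact_mod_cast hn2)
  have hP : ∀ x, 0 < prodDist p n x → prodDist p n x = (2 : ℝ) ^ (-(n * H)) := by
    intro x hx
    rw [← Real.rpow_logb (b := 2) (by norm_num) (by norm_num) hx, logb_prodDist p hp n x hx]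
    congr 1
    rw [Finset.sum_congr rfl fun j _ => hW (x j) ((hp _).lt_of_ne fun h0 => hx.ne' <|
      Finset.prod_eq_zero (Finset.mem_univ j) h0.symm)]
    simp
  simp only [mul_zero, Real.sqrt_zero, zero_mul, add_zero, one_mul]
  constructor
  · rw [Finset.sum_filter_of_ne, prodDist_sum p hps]
    · exact hq1.le
    · intro x _ hx
      rw [hP x ((prodDist_nonneg p hp n x).lt_of_ne hx.symm)]
      exact Real.rpow_le_rpow_of_exponent_le (by norm_num) (by linarith)
  · rw [Finset.filter_false_of_mem, Finset.sum_empty]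
    · linarith [hN n hn]
    · intro x _ hx
      have h0 : 0 < prodDist p n x := lt_trans (by positivity) hx
      rw [hP x h0, Real.rpow_lt_rpow_left_iff (by norm_num)] at hx
      linarith

lemma classical_case_pos (p : Fin d → ℝ) (hp : ∀ x, 0 ≤ p x) (hps : ∑ x, p x = 1)
    (q H V : ℝ) (hq0 : 0 < q) (hq1 : q < 1)
    (hH : H = -∑ x, p x * Real.logb 2 (p x))
    (hV : V = ∑ x, p x * (Real.logb 2 (p x)) ^ 2 - (∑ x, p x * Real.logb 2 (p x)) ^ 2)
    (hV0 : 0 < V) :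
    ∃ C : ℝ, 0 < C ∧ ∃ N : ℕ, ∀ n : ℕ, N ≤ n → 2 ≤ n →
      (q ≤ ∑ x ∈ univ.filter (fun x => (2 : ℝ) ^ (-((n * H + Real.sqrt (n * V) * PhiInv q)
        + C * Real.logb 2 n)) ≤ prodDist p n x), prodDist p n x) ∧
      (∑ x ∈ univ.filter (fun x => (2 : ℝ) ^ (-((n * H + Real.sqrt (n * V) * PhiInv q)
        - C * Real.logb 2 n)) < prodDist p n x), prodDist p n x < q - 1 / Real.sqrt n) := by
  have hs0 : 0 < Real.sqrt V := Real.sqrt_pos.mpr hV0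
  have hss : Real.sqrt V ^ 2 = V := Real.sq_sqrt hV0.le
  set Y : Fin d → ℝ := fun x => (-Real.logb 2 (p x) - H) / Real.sqrt V with hY
  have hsum : ∑ x, p x * Real.logb 2 (p x) = -H := by linarith
  have h1 : ∑ x, p x * Y x = 0 := by
    have : ∀ x, p x * Y x = (-(p x * Real.logb 2 (p x)) - p x * H) / Real.sqrt V := by
      intro x; rw [hY]; ring
    rw [Finset.sum_congr rfl fun x _ => this x, ← Finset.sum_div, Finset.sum_sub_distrib,
      Finset.sum_neg_distrib, ← Finset.sum_mul, hps, hsum]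
    simp
  have h2 : ∑ x, p x * Y x ^ 2 = 1 := by
    have : ∀ x, p x * Y x ^ 2 = (p x * (Real.logb 2 (p x)) ^ 2
        + 2 * H * (p x * Real.logb 2 (p x)) + p x * H ^ 2) / V := by
      intro x; rw [hY]; simp only [div_pow, hss]; ring
    rw [Finset.sum_congr rfl fun x _ => this x, ← Finset.sum_div, Finset.sum_add_distrib,
      Finset.sum_add_distrib, ← Finset.sum_mul, ← Finset.mul_sum, hps, hsum]
    rw [hsum] at hV
    rw [div_eq_one_iff_eq hV0.ne']
    linarith
  obtain ⟨C1, hC1, hBE⟩ := berry_esseen p Y hp hps h1 h2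
  obtain ⟨m, hm, hPhi⟩ := phiInv_spec q hq0 hq1
  set z0 := PhiInv q
  set K := (C1 + 1) / m with hK
  have hK0 : 0 < K := by positivity
  have hmK : m * K = C1 + 1 := by rw [hK]; field_simp
  obtain ⟨N, hN⟩ := eventually_atTop.mp
    (logdiv_tendsto.eventually_lt_const (show (0 : ℝ) < 1 / K by positivity))
  have hl2 : 0 < Real.log 2 := Real.log_pos (by norm_num)
  refine ⟨Real.sqrt V * K * Real.log 2 + 1, by positivity, max N 3, fun n hn hn2 => ?_⟩
  have hn3 : 3 ≤ n := (le_max_right _ _).trans hn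
  have hnR : (3 : ℝ) ≤ n := by exact_mod_cast hn3
  have hL : 0 < Real.logb 2 n := Real.logb_pos (by norm_num) (by linarith)
  have hr0 : 0 < Real.sqrt n := Real.sqrt_pos.mpr (by linarith)
  have hrr : Real.sqrt n * Real.sqrt n = n := Real.mul_self_sqrt (by linarith)
  have hlog : Real.log 2 * Real.logb 2 n = Real.log n := by
    rw [Real.logb]; field_simp
  have hlog1 : 1 < Real.log n := by
    rw [Real.lt_log_iff_exp_lt (by linarith)]
    linarith [Real.exp_one_lt_d9]
  set D := Real.log n / Real.sqrt n with hD
  have hD0 : 1 / Real.sqrt n < D := by rw [hD]; gcongr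
  have hD00 : 0 < D := lt_trans (by positivity) hD0
  set u := K * D with hu
  have hu0 : 0 ≤ u := by positivity
  have hu1 : u ≤ 1 := by
    have := hN n ((le_max_left _ _).trans hn)
    rw [lt_div_iff₀ hK0] at this
    rw [hu]; linarith
  obtain ⟨hA, hB⟩ := hPhi u hu0 hu1
  have hmu : m * u = (C1 + 1) * D := by rw [hu, ← mul_assoc, hmK]
  have hCu : Real.sqrt (n * V) * u = Real.sqrt V * K * Real.log 2 * Real.logb 2 n := by
    rw [mul_assoc _ (Real.log 2), hlog, hu, hD, Real.sqrt_mul (by linarith)]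
    field_simp
  -- key equivalence on the support
  have key : ∀ (z : ℝ) (x : Fin n → Fin d), 0 < prodDist p n x →
      ((∑ j, Y (x j)) / Real.sqrt n ≤ z ↔
        -Real.logb 2 (prodDist p n x) ≤ n * H + Real.sqrt (n * V) * z) := by
    intro z x hx
    have : ∑ j, Y (x j) = (-Real.logb 2 (prodDist p n x) - n * H) / Real.sqrt V := by
      rw [logb_prodDist p hp n x hx, hY]
      simp only
      rw [← Finset.sum_div, Finset.sum_sub_distrib, Finset.sum_neg_distrib]
      simp
    rw [this, div_div, div_le_iff₀ (by positivity), Real.sqrt_mul (by linarith)]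
    constructor <;> intro h <;> linarith
  constructor
  · have hbe := (abs_le.mp (hBE n hn3 (z0 + u))).1
    have hle : ∑ x ∈ Finset.univ.filter (fun x : Fin n → Fin d =>
          (∑ j, Y (x j)) / Real.sqrt n ≤ z0 + u), ∏ j, p (x j)
        ≤ ∑ x ∈ univ.filter (fun x => (2 : ℝ) ^ (-((n * H + Real.sqrt (n * V) * z0)
        + (Real.sqrt V * K * Real.log 2 + 1) * Real.logb 2 n)) ≤ prodDist p n x),
          prodDist p n x := by
      rw [Finset.sum_filter, Finset.sum_filter]
      refine Finset.sum_le_sum fun x _ => ?_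
      change (if _ then prodDist p n x else 0) ≤ _
      rcases (prodDist_nonneg p hp n x).eq_or_lt with h0 | h0
      · rw [← h0]; simp
      · split_ifs with ha hb hb
        · exact le_rfl
        · exfalso
          apply hb
          rw [key _ _ h0] at ha
          rw [← Real.le_logb_iff_rpow_le (by norm_num) h0]
          linarith
        · exact h0.le
        · exact le_rfl
    linarith
  · have hbe := (abs_le.mp (hBE n hn3 (z0 - u))).2
    have hle : ∑ x ∈ univ.filter (fun x => (2 : ℝ) ^ (-((n * H + Real.sqrt (n * V) * z0)
        - (Real.sqrt V * K * Real.log 2 + 1) * Real.logb 2 n)) < prodDist p n x),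
          prodDist p n x ≤ ∑ x ∈ Finset.univ.filter (fun x : Fin n → Fin d =>
          (∑ j, Y (x j)) / Real.sqrt n ≤ z0 - u), ∏ j, p (x j) := by
      rw [Finset.sum_filter, Finset.sum_filter]
      refine Finset.sum_le_sum fun x _ => ?_
      change _ ≤ (if _ then prodDist p n x else 0)
      rcases (prodDist_nonneg p hp n x).eq_or_lt with h0 | h0
      · rw [← h0]; simp
      · split_ifs with ha hb hb
        · exact le_rfl
        · exfalso
          apply hb
          rw [key _ _ h0]
          rw [← Real.lt_logb_iff_rpow_lt (by norm_num) h0] at ha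
          linarith
        · exact h0.le
        · exact le_rfl
    linarith

lemma classical_bounds (p : Fin d → ℝ) (hp : ∀ x, 0 ≤ p x) (hps : ∑ x, p x = 1)
    (q H V : ℝ) (hq0 : 0 < q) (hq1 : q < 1)
    (hH : H = -∑ x, p x * Real.logb 2 (p x))
    (hV : V = ∑ x, p x * (Real.logb 2 (p x)) ^ 2 - (∑ x, p x * Real.logb 2 (p x)) ^ 2) :
    ∃ C : ℝ, 0 < C ∧ ∃ N : ℕ, ∀ n : ℕ, N ≤ n → 2 ≤ n →
      (q ≤ ∑ x ∈ univ.filter (fun x => (2 : ℝ) ^ (-((n * H + Real.sqrt (n * V) * PhiInv q)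
        + C * Real.logb 2 n)) ≤ prodDist p n x), prodDist p n x) ∧
      (∑ x ∈ univ.filter (fun x => (2 : ℝ) ^ (-((n * H + Real.sqrt (n * V) * PhiInv q)
        - C * Real.logb 2 n)) < prodDist p n x), prodDist p n x < q - 1 / Real.sqrt n) := by
  have hVs : V = ∑ x, p x * (Real.logb 2 (p x) + H) ^ 2 := by
    have : ∀ x, p x * (Real.logb 2 (p x) + H) ^ 2 = p x * (Real.logb 2 (p x)) ^ 2
        + 2 * H * (p x * Real.logb 2 (p x)) + p x * H ^ 2 := by
      intro x; ring
    rw [Finset.sum_congr rfl fun x _ => this x, Finset.sum_add_distrib,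
      Finset.sum_add_distrib, ← Finset.sum_mul, ← Finset.mul_sum, hps, hV, hH]
    ring
  have hnn : ∀ x ∈ univ, 0 ≤ p x * (Real.logb 2 (p x) + H) ^ 2 :=
    fun x _ => mul_nonneg (hp x) (sq_nonneg _)
  have hV0 : 0 ≤ V := hVs ▸ Finset.sum_nonneg hnn
  rcases hV0.eq_or_lt with h0 | h0
  · have hW : ∀ x, 0 < p x → Real.logb 2 (p x) = -H := by
      intro x hx
      have h := (Finset.sum_eq_zero_iff_of_nonneg hnn).mp (hVs.symm.trans h0.symm) x
        (Finset.mem_univ x)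
      have h' := (mul_eq_zero.mp h).resolve_left hx.ne'
      have := pow_eq_zero_iff (two_ne_zero) |>.mp h'
      linarith
    rw [← h0]
    exact classical_case_zero p hp hps q (PhiInv q) H hq0 hq1 hW
  · exact classical_case_pos p hp hps q H V hq0 hq1 hH hV h0

lemma quantum_bounds (p : Fin d → ℝ) (hp : ∀ x, 0 ≤ p x) (hps : ∑ x, p x = 1)
    (ε : ℝ) (hε : ε ∈ Set.Ioo (0 : ℝ) 1) (n : ℕ) (hn : 2 ≤ n) (θ C : ℝ)
    (ha : Real.sqrt (1 - ε ^ 2) ≤ ∑ x ∈ univ.filter (fun x => (2 : ℝ) ^ (-(θ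
        + C * Real.logb 2 n)) ≤ prodDist p n x), prodDist p n x)
    (hb : ∑ x ∈ univ.filter (fun x => (2 : ℝ) ^ (-(θ
        - C * Real.logb 2 n)) < prodDist p n x), prodDist p n x
          < Real.sqrt (1 - ε ^ 2) - 1 / Real.sqrt n) :
    |-(HminPartialPure p ε n) - θ| ≤ (C + 1) * Real.logb 2 n := by
  have hn0 : (0 : ℝ) < n := by positivity
  have hL : 0 < Real.logb 2 n := Real.logb_pos (by norm_num) (by exact_mod_cast hn)
  have he0 : 0 ≤ 1 - ε ^ 2 := by nlinarith [hε.1, hε.2]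
  have hP := prodDist_nonneg p hp n
  have hPs := prodDist_sum p hps n
  rw [HminPartialPure, neg_neg]
  set Λ := {l : ℝ | 0 ≤ l ∧
    ∃ σ : Matrix ((Fin n → Fin d) × (Fin n → Fin d))
            ((Fin n → Fin d) × (Fin n → Fin d)) ℂ,
      ((l : ℂ) • ((1 : Matrix (Fin n → Fin d) (Fin n → Fin d) ℂ) ⊗ₖ
          (Matrix.diagonal fun x => (prodDist p n x : ℂ))) - σ).PosSemidef ∧
      1 - ε ^ 2 ≤ (((outer fun xy : (Fin n → Fin d) × (Fin n → Fin d) =>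
          if xy.1 = xy.2 then (Real.sqrt (prodDist p n xy.1) : ℂ) else 0) * σ).trace).re ∧
      ((Matrix.diagonal fun x => (prodDist p n x : ℂ)) - ptraceA σ).PosSemidef ∧
      σ.PosSemidef} with hΛ
  set S := univ.filter (fun x => (2 : ℝ) ^ (-(θ + C * Real.logb 2 n)) ≤ prodDist p n x) with hS
  have hSmem : ((S.card : ℕ) : ℝ) ∈ Λ :=
    ⟨Nat.cast_nonneg _, achiev (prodDist p n) hP (1 - ε ^ 2) S ha he0⟩
  have hcard : (S.card : ℝ) ≤ (2 : ℝ) ^ (θ + C * Real.logb 2 n) := by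
    have h1 : (S.card : ℝ) * (2 : ℝ) ^ (-(θ + C * Real.logb 2 n)) ≤ 1 := by
      rw [← hPs, ← nsmul_eq_mul]
      refine (Finset.card_nsmul_le_sum S (prodDist p n) _ fun x hx => ?_).trans
        (Finset.sum_le_sum_of_subset_of_nonneg (Finset.subset_univ _) fun x _ _ => hP x)
      exact (Finset.mem_filter.mp hx).2
    rw [Real.rpow_neg (by norm_num), ← div_eq_mul_inv, div_le_one (by positivity)] at h1
    exact h1
  have hlow : ∀ l ∈ Λ, (2 : ℝ) ^ (θ - (C + 1) * Real.logb 2 n) ≤ l := by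
    rintro l ⟨hl0, σ, h1, h2, h3, h4⟩
    by_contra! hlt
    set t : ℝ := (2 : ℝ) ^ (-(θ - C * Real.logb 2 n)) with ht
    have ht0 : 0 < t := by positivity
    have hc := converse_bound (prodDist p n) hP hPs l (1 - ε ^ 2) t hl0 ht0.le σ h1 h2 h3 h4
    have hprod : (2 : ℝ) ^ (θ - (C + 1) * Real.logb 2 n) * t = 1 / n := by
      rw [ht, ← Real.rpow_add (by norm_num),
        show θ - (C + 1) * Real.logb 2 n + -(θ - C * Real.logb 2 n) = -Real.logb 2 n by ring,
        Real.rpow_neg (by norm_num), Real.rpow_logb (by norm_num) (by norm_num) hn0, one_div]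
    have hlt' : l * t ≤ 1 / n := by
      rw [← hprod]; exact mul_le_mul_of_nonneg_right hlt.le ht0.le
    have hsq := Real.sqrt_le_sqrt hlt'
    rw [Real.sqrt_div (by norm_num), Real.sqrt_one] at hsq
    linarith
  have hne : Λ.Nonempty := ⟨_, hSmem⟩
  have hInfl := le_csInf hne hlow
  have hInf0 : 0 < sInf Λ := lt_of_lt_of_le (by positivity) hInfl
  have hInfu : sInf Λ ≤ (2 : ℝ) ^ (θ + C * Real.logb 2 n) :=
    (csInf_le ⟨0, fun l hl => hl.1⟩ hSmem).trans hcard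
  have hlo := (Real.le_logb_iff_rpow_le (by norm_num) hInf0).mpr hInfl
  have hup := (Real.logb_le_iff_le_rpow (by norm_num) hInf0).mpr hInfu
  rw [abs_le]
  constructor <;> linarith

end Final

/-- Theorem 2 of the paper: second-order expansion of the partially
smoothed conditional min-entropy of a pure bipartite i.i.d. state,
`−H_min^{ε,P}(A|Ṙ)_{ρ^⊗n} = n H(A) + √(n V(A)) Φ⁻¹(√(1−ε²)) + O(log n)`,
where `H(A) = −Σ p_x log₂ p_x` and `V(A) = Σ p_x (log₂ p_x)² − H(A)²`. -/
theorem hmin_partial_pure_second_order {d : ℕ} (p : Fin d → ℝ)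
    (hp : ∀ x, 0 ≤ p x) (hps : ∑ x, p x = 1) (ε : ℝ) (hε : ε ∈ Set.Ioo (0 : ℝ) 1) :
    ∃ C : ℝ, 0 < C ∧ ∀ n : ℕ, 2 ≤ n →
      |(-(HminPartialPure p ε n)) -
        ((n : ℝ) * (-∑ x, p x * Real.logb 2 (p x)) +
          Real.sqrt ((n : ℝ) * ((∑ x, p x * (Real.logb 2 (p x)) ^ 2) -
            (∑ x, p x * Real.logb 2 (p x)) ^ 2)) * PhiInv (Real.sqrt (1 - ε ^ 2)))|
      ≤ C * Real.logb 2 n := by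
  have he0 : 0 < 1 - ε ^ 2 := by nlinarith [hε.1, hε.2]
  have hq0 : 0 < Real.sqrt (1 - ε ^ 2) := Real.sqrt_pos.mpr he0
  have hq1 : Real.sqrt (1 - ε ^ 2) < 1 := by
    rw [Real.sqrt_lt' one_pos]
    nlinarith [pow_pos hε.1 2]
  obtain ⟨C, hC, N, hN⟩ := classical_bounds p hp hps (Real.sqrt (1 - ε ^ 2)) _ _ hq0 hq1 rfl rfl
  set G : ℕ → ℝ := fun n => |(-(HminPartialPure p ε n)) -
        ((n : ℝ) * (-∑ x, p x * Real.logb 2 (p x)) +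
          Real.sqrt ((n : ℝ) * ((∑ x, p x * (Real.logb 2 (p x)) ^ 2) -
            (∑ x, p x * Real.logb 2 (p x)) ^ 2)) * PhiInv (Real.sqrt (1 - ε ^ 2)))| with hG
  have hG0 : ∀ n, 0 ≤ G n := fun n => abs_nonneg _
  have hGs : 0 ≤ ∑ n ∈ Finset.range N, G n := Finset.sum_nonneg fun n _ => hG0 n
  refine ⟨C + 1 + ∑ n ∈ Finset.range N, G n, by positivity, fun n hn => ?_⟩
  change G n ≤ _
  have hL : 1 ≤ Real.logb 2 n := by
    rw [Real.le_logb_iff_rpow_le (by norm_num) (by positivity), Real.rpow_one]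
    exact_mod_cast hn
  rcases lt_or_ge n N with h | h
  · have h1 : G n ≤ ∑ n ∈ Finset.range N, G n :=
      Finset.single_le_sum (fun i _ => hG0 i) (Finset.mem_range.mpr h)
    have h2 : (C + 1 + ∑ n ∈ Finset.range N, G n) * 1 ≤
      (C + 1 + ∑ n ∈ Finset.range N, G n) * Real.logb 2 n :=
      mul_le_mul_of_nonneg_left hL (by positivity)
    linarith
  · obtain ⟨ha, hb⟩ := hN n h hn
    have h1 := quantum_bounds p hp hps ε hε n hn _ C ha hb
    refine h1.trans ?_
    exact mul_le_mul_of_nonneg_right (by linarith) (by linarith)
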